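/- arXiv:2402.17720 — 2 statements merged into one kernel-verified Lean document; each statement's English description precedes it below -/
import Mathlib

section
/- Local asymptotics for the equalization count: let C ≥ 1 be a real constant, n ≥ 32C² an even integer, and k an integer with 0 ≤ k ≤ C√n. Set p_{n,k} := 2^{−(n−k)} · binom(n−k, n/2). Then e^{−16C³/√n} ≤ p_{n,k} / (√(2/(nπ)) · e^{−k²/(2n)}) ≤ √((1 − C/√n)/(1 − 2C/√n)) · e^{16C³/√n}. -/
open Real in
theorem centralBinom_div_four_pow_sq (m : ℕ) :
    ((m.centralBinom : ℝ) / 4 ^ m) ^ 2 = 1 / ((2 * m + 1) * Wallis.W m) := by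
  induction m with
  | zero => simp [Wallis.W]
  | succ m ih =>
    have h : ((m + 1 : ℕ) : ℝ) * ((m + 1).centralBinom : ℝ)
        = 2 * (2 * m + 1) * m.centralBinom := by
      exact_mod_cast Nat.succ_mul_centralBinom_succ m
    have hm : ((m + 1).centralBinom : ℝ) / 4 ^ (m + 1)
        = (2 * m + 1) / (2 * m + 2) * (m.centralBinom / 4 ^ m) := by
      push_cast at h
      rw [pow_succ]
      field_simp
      linear_combination 2 * h
    have hW := Wallis.W_pos m
    rw [hm, mul_pow, ih, Wallis.W_succ]
    push_cast
    field_simp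
    ring

open Real in
theorem centralBinom_div_four_pow_le {m : ℕ} (hm : 0 < m) :
    (m.centralBinom : ℝ) / 4 ^ m ≤ √(2 / ((2 * m : ℝ) * π)) := by
  apply Real.le_sqrt_of_sq_le
  rw [centralBinom_div_four_pow_sq]
  have hm' : (0 : ℝ) < m := by exact_mod_cast hm
  have hW := Wallis.le_W m
  have hpi := Real.pi_pos
  rw [div_le_div_iff₀ (mul_pos (by positivity) (Wallis.W_pos m)) (by positivity)]
  have : (2 * m + 1 : ℝ) * ((2 * m + 1) / (2 * m + 2) * (π / 2)) ≤ (2 * m + 1) * Wallis.W m := by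
    gcongr
  refine le_trans ?_ (mul_le_mul_of_nonneg_left this zero_le_two)
  field_simp
  nlinarith

open Real in
theorem exp_neg_mul_sqrt_le_centralBinom_div_four_pow {m : ℕ} (hm : 0 < m) :
    exp (-(1 / (2 * (2 * m : ℝ)))) * √(2 / ((2 * m : ℝ) * π)) ≤ (m.centralBinom : ℝ) / 4 ^ m := by
  refine le_of_sq_le_sq ?_ (by positivity)
  have hm' : (0 : ℝ) < m := by exact_mod_cast hm
  have hpi := Real.pi_pos
  rw [centralBinom_div_four_pow_sq, mul_pow, Real.sq_sqrt (by positivity), ← Real.exp_nat_mul]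
  have hW := Wallis.W_le m
  have hW0 := Wallis.W_pos m
  have h1 : exp ((2 : ℕ) * -(1 / (2 * (2 * m : ℝ)))) ≤ 2 * m / (2 * m + 1) := by
    have := Real.add_one_le_exp (1 / (2 * m : ℝ))
    have h2 : ((2 : ℕ) * -(1 / (2 * (2 * m : ℝ)))) = -(1 / (2 * m : ℝ)) := by
      push_cast; field_simp
    rw [h2, Real.exp_neg, inv_le_comm₀ (exp_pos _) (by positivity)]
    refine le_trans (le_of_eq ?_) this
    field_simp
    ring
  calc _ ≤ 2 * m / (2 * m + 1) * (2 / (2 * m * π)) := by gcongr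
    _ = 1 / ((2 * m + 1) * (π / 2)) := by field_simp
    _ ≤ _ := by gcongr

theorem choose_div_two_pow_succ {n m k : ℕ} (hn : n = 2 * m) (hk : k < m) :
    ((n - (k + 1)).choose m : ℝ) / 2 ^ (n - (k + 1))
      = (1 - k / (n - k)) * (((n - k).choose m : ℝ) / 2 ^ (n - k)) := by
  obtain ⟨d, rfl⟩ : ∃ d, m = k + 1 + d := ⟨m - (k + 1), by omega⟩
  subst hn
  rw [show 2 * (k + 1 + d) - (k + 1) = k + 1 + 2 * d by omega,
    show 2 * (k + 1 + d) - k = k + 1 + 2 * d + 1 by omega]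
  have h := Nat.choose_mul_succ_eq (k + 1 + 2 * d) (k + 1 + d)
  rw [show k + 1 + 2 * d + 1 - (k + 1 + d) = d + 1 by omega] at h
  have h' : ((k + 1 + 2 * d).choose (k + 1 + d) : ℝ) * (k + 1 + 2 * d + 1)
      = (k + 1 + 2 * d + 1).choose (k + 1 + d) * (d + 1) := by exact_mod_cast h
  push_cast
  have h3 : (2 * (k + 1 + d) - k : ℝ) = k + 1 + 2 * d + 1 := by ring
  rw [h3, pow_succ]
  field_simp
  linear_combination 2 * h'

open Real in
theorem choose_div_two_pow_le {n m k : ℕ} (hn : n = 2 * m) (hk : k ≤ m) (hm : 0 < m) :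
    ((n - k).choose m : ℝ) / 2 ^ (n - k)
      ≤ ((n.choose m : ℝ) / 2 ^ n) * exp (-(k * (k - 1) / (2 * n))) := by
  induction k with
  | zero => simp
  | succ k ih =>
    rw [choose_div_two_pow_succ hn (by omega)]
    have hm' : (0 : ℝ) < m := by exact_mod_cast hm
    have hnr : (n : ℝ) = 2 * m := by exact_mod_cast hn
    have hkm : (k + 1 : ℝ) ≤ m := by exact_mod_cast hk
    have hk0 : (0 : ℝ) ≤ k := k.cast_nonneg
    have h1 : (k : ℝ) / n ≤ k / (n - k) := by
      apply div_le_div_of_nonneg_left <;> linarith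
    have h2 : 1 - (k : ℝ) / (n - k) ≤ exp (-(k / n)) := by
      have := Real.add_one_le_exp (-(k / n : ℝ))
      linarith
    refine (mul_le_mul h2 (ih (by omega)) (by positivity) (by positivity)).trans (le_of_eq ?_)
    have h4 : -(((k + 1 : ℕ) : ℝ) * ((k + 1 : ℕ) - 1) / (2 * n))
        = -(k / n : ℝ) + -(k * (k - 1) / (2 * n)) := by
      have : (n : ℝ) ≠ 0 := by rw [hnr]; positivity
      push_cast
      field_simp
      ring
    rw [h4, Real.exp_add]
    ring

open Real in
theorem le_choose_div_two_pow {n m k : ℕ} (hn : n = 2 * m) (hk : 4 * k ≤ n) (hm : 0 < m) :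
    ((n.choose m : ℝ) / 2 ^ n) * exp (-(k ^ 2 / (2 * n) + 4 * k ^ 3 / n ^ 2))
      ≤ ((n - k).choose m : ℝ) / 2 ^ (n - k) := by
  induction k with
  | zero => simp
  | succ k ih =>
    rw [choose_div_two_pow_succ hn (by omega)]
    have hn0 : (0 : ℝ) < n := by exact_mod_cast (by omega : 0 < n)
    have hkn : (4 * (k + 1) : ℝ) ≤ n := by exact_mod_cast hk
    have hk0 : (0 : ℝ) ≤ k := k.cast_nonneg
    have h1 : (0 : ℝ) < n - k := by linarith
    have h2 : (0 : ℝ) < n - 2 * k := by linarith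
    have h3 : exp (-(k / n + 4 * k ^ 2 / n ^ 2)) ≤ 1 - (k : ℝ) / (n - k) := by
      have h4 : 1 - (k : ℝ) / (n - k) = (n - 2 * k) / (n - k) := by
        field_simp
        ring
      rw [h4, Real.exp_neg, inv_le_comm₀ (exp_pos _) (by positivity), inv_div]
      refine le_trans ?_ (Real.add_one_le_exp _)
      have h5 : (k / n + 4 * k ^ 2 / n ^ 2 + 1 : ℝ) - (n - k) / (n - 2 * k)
          = 2 * k ^ 2 * (n - 4 * k) / (n ^ 2 * (n - 2 * k)) := by
        have := h2.ne'
        rw [div_add_div _ _ hn0.ne' (by positivity), div_add_one (by positivity),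
          div_sub_div _ _ (by positivity) this, div_eq_div_iff (by positivity) (by positivity)]
        ring
      have h6 : (0 : ℝ) ≤ 2 * k ^ 2 * (n - 4 * k) / (n ^ 2 * (n - 2 * k)) := by
        have : (0 : ℝ) ≤ n - 4 * k := by linarith
        positivity
      linarith
    refine le_trans ?_ (mul_le_mul h3 (ih (by omega)) (by positivity) ((exp_pos _).le.trans h3))
    rw [mul_left_comm, ← Real.exp_add]
    gcongr
    push_cast
    have h7 : ((k + 1 : ℝ) ^ 2 / (2 * n) + 4 * (k + 1) ^ 3 / n ^ 2)
        - ((k / n + 4 * k ^ 2 / n ^ 2) + (k ^ 2 / (2 * n) + 4 * k ^ 3 / n ^ 2))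
        = 1 / (2 * n) + 4 * (2 * k ^ 2 + 3 * k + 1) / n ^ 2 := by
      field_simp
      ring
    have h8 : (0 : ℝ) ≤ 1 / (2 * n) + 4 * (2 * k ^ 2 + 3 * k + 1) / n ^ 2 := by positivity
    linarith


/-- **Local asymptotics for the equalization count.** For a real `C ≥ 1`, an even
integer `n ≥ 32C²`, and an integer `0 ≤ k ≤ C√n`, the probability
`p_{n,k} = 2^{-(n-k)} binom (n-k) (n/2)` satisfies
`e^{-16C³/√n} ≤ p_{n,k} / (√(2/(nπ)) e^{-k²/(2n)})
  ≤ √((1 - C/√n)/(1 - 2C/√n)) · e^{16C³/√n}`. -/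
theorem pnk_local_asymptotics
    (C : ℝ) (hC : 1 ≤ C) (n : ℕ) (hev : Even n) (hn : 32 * C ^ 2 ≤ (n : ℝ))
    (k : ℕ) (hk : (k : ℝ) ≤ C * Real.sqrt n) :
    Real.exp (-(16 * C ^ 3 / Real.sqrt n))
        ≤ (((n - k).choose (n / 2) : ℝ) / 2 ^ (n - k))
            / (Real.sqrt (2 / (n * Real.pi)) * Real.exp (-((k : ℝ) ^ 2) / (2 * n)))
    ∧ (((n - k).choose (n / 2) : ℝ) / 2 ^ (n - k))
            / (Real.sqrt (2 / (n * Real.pi)) * Real.exp (-((k : ℝ) ^ 2) / (2 * n)))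
        ≤ Real.sqrt ((1 - C / Real.sqrt n) / (1 - 2 * C / Real.sqrt n))
            * Real.exp (16 * C ^ 3 / Real.sqrt n) := by
  obtain ⟨m, hm2⟩ := hev
  have hnm : n = 2 * m := by omega
  have hn0 : (0 : ℝ) < n := by nlinarith
  have hm : 0 < m := by
    have : 0 < n := by exact_mod_cast hn0
    omega
  have hnr : (n : ℝ) = 2 * m := by exact_mod_cast hnm
  set s := Real.sqrt n with hs
  have hs0 : 0 < s := Real.sqrt_pos.mpr hn0
  have hss : s ^ 2 = n := Real.sq_sqrt hn0.le
  have hCs : 4 * C ≤ s := by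
    apply Real.le_sqrt_of_sq_le
    nlinarith
  have hk0 : (0 : ℝ) ≤ k := k.cast_nonneg
  have h4k : 4 * k ≤ n := by
    have : (4 * k : ℝ) ≤ n := by nlinarith
    exact_mod_cast this
  have hdiv : n / 2 = m := by omega
  rw [hdiv]
  have hcb : (n.choose m : ℝ) / 2 ^ n = (m.centralBinom : ℝ) / 4 ^ m := by
    rw [hnm, Nat.centralBinom, pow_mul]
    norm_num
  have hup := choose_div_two_pow_le hnm (by omega : k ≤ m) hm
  have hlo := le_choose_div_two_pow hnm h4k hm
  have hcup := centralBinom_div_four_pow_le hm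
  have hclo := exp_neg_mul_sqrt_le_centralBinom_div_four_pow hm
  rw [hcb] at hup hlo
  rw [← hnr] at hcup hclo
  have hsq : 0 < Real.sqrt (2 / (n * Real.pi)) := by
    have := Real.pi_pos
    positivity
  have hC3 : C ≤ C ^ 3 := le_self_pow₀ hC (by norm_num)
  constructor
  · rw [le_div_iff₀ (by positivity)]
    refine le_trans ?_ ((mul_le_mul_of_nonneg_right hclo (Real.exp_pos _).le).trans hlo)
    rw [mul_left_comm, ← Real.exp_add, mul_right_comm, ← Real.exp_add, mul_comm]
    refine mul_le_mul_of_nonneg_right (Real.exp_le_exp.2 ?_) hsq.le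
    have hk3 : 4 * (k : ℝ) ^ 3 / n ^ 2 ≤ 4 * C ^ 3 / s := by
      calc 4 * (k : ℝ) ^ 3 / n ^ 2 ≤ 4 * (C * s) ^ 3 / n ^ 2 := by gcongr
        _ = 4 * C ^ 3 / s := by
          rw [← hss]
          field_simp
    have h1n : 1 / (2 * (n : ℝ)) ≤ C ^ 3 / s := by
      rw [div_le_div_iff₀ (by positivity) hs0, ← hss]
      nlinarith [mul_le_mul_of_nonneg_right (hC.trans hC3) (sq_nonneg s)]
    have h16 : 16 * C ^ 3 / s = 4 * C ^ 3 / s + C ^ 3 / s + 11 * (C ^ 3 / s) := by ring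
    have hpos : 0 ≤ C ^ 3 / s := by positivity
    rw [neg_div]
    linarith
  · rw [div_le_iff₀ (by positivity)]
    have hroot : 1 ≤ Real.sqrt ((1 - C / s) / (1 - 2 * C / s)) := by
      rw [Real.one_le_sqrt, one_le_div]
      · have : 0 ≤ C / s := by positivity
        rw [mul_div_assoc]
        linarith
      · rw [sub_pos, div_lt_one hs0]
        linarith
    have hmain : Real.exp (-((k : ℝ) * (k - 1) / (2 * n)))
        ≤ Real.exp (16 * C ^ 3 / s) * Real.exp (-((k : ℝ) ^ 2) / (2 * n)) := by
      rw [← Real.exp_add]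
      gcongr
      have h1 : -((k : ℝ) * (k - 1) / (2 * n)) = k / (2 * n) + -((k : ℝ) ^ 2) / (2 * n) := by ring
      have h2 : (k : ℝ) / (2 * n) ≤ 16 * C ^ 3 / s := by
        calc (k : ℝ) / (2 * n) ≤ C * s / (2 * n) := by gcongr
          _ = (C / 2) / s := by
            rw [← hss]
            field_simp
          _ ≤ _ := by
            gcongr
            linarith
      linarith
    calc _ ≤ _ := hup
      _ ≤ Real.sqrt (2 / (n * Real.pi))
          * (Real.exp (16 * C ^ 3 / s) * Real.exp (-((k : ℝ) ^ 2) / (2 * n))) := by gcongr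
      _ ≤ Real.sqrt ((1 - C / s) / (1 - 2 * C / s)) * (Real.sqrt (2 / (n * Real.pi))
          * (Real.exp (16 * C ^ 3 / s) * Real.exp (-((k : ℝ) ^ 2) / (2 * n)))) :=
        le_mul_of_one_le_left (by positivity) hroot
      _ = _ := by ring
end

section
/- Limiting normalized truncated lead-change count: for even n, let E_n := 2^{−n} ∑_{y∈{0,1}^n} min{ c(y_1,…,y_n), √(2(n+1)/π) } and a_n := √(2(n+1)/π). Then lim_{n→∞, n even} E_n / a_n = 1 − e^{−1/π} + 2·Q(√(2/π)), where Q(x) := (1/√(2π)) ∫_x^∞ e^{−t²/2} dt is the standard Gaussian tail function. -/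
/-- `extSeq n y` is the `{0,1}`-valued sequence on `ℕ` (indexed `1, …, n`)
corresponding to the bit vector `y : Fin n → Bool` (and `0` outside `[1, n]`). -/
def extSeq (n : ℕ) (y : Fin n → Bool) : ℕ → ℕ :=
  fun i => if h : 1 ≤ i ∧ i ≤ n then (if y ⟨i - 1, by omega⟩ then 1 else 0) else 0

/-- `leadCount t Y` is the lead-change count of the prefix `(Y 1, …, Y t)`:
the number of `0 ≤ j ≤ t` with `∑_{i=1}^j Y i = ∑_{i=1}^j (1 - Y i)`,
i.e. `2 ∑_{i=1}^j Y i = j` (note `j = 0` always counts). -/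
def leadCount (t : ℕ) (Y : ℕ → ℕ) : ℕ :=
  ((Finset.range (t + 1)).filter (fun j => 2 * ∑ i ∈ Finset.Icc 1 j, Y i = j)).card

/-- `En n = 2^{-n} ∑_{y ∈ {0,1}^n} min (c (y₁,…,y_n)) √(2(n+1)/π)`:
the expected truncated lead-change count of `n` i.i.d. uniform bits. -/
noncomputable def En (n : ℕ) : ℝ :=
  ((2 : ℝ) ^ n)⁻¹ * ∑ y : Fin n → Bool,
    min ((leadCount n (extSeq n y) : ℝ)) (Real.sqrt (2 * (n + 1) / Real.pi))

/-- `an n = √(2(n+1)/π)`, twice the asymptotic minimax regret of horizon-`(n+1)`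
binary prediction. -/
noncomputable def an (n : ℕ) : ℝ := Real.sqrt (2 * (n + 1) / Real.pi)

/-- `Q x = (1/√(2π)) ∫_x^∞ e^{-t²/2} dt`, the standard Gaussian tail function. -/
noncomputable def gaussQ (x : ℝ) : ℝ :=
  (Real.sqrt (2 * Real.pi))⁻¹ * ∫ t in Set.Ioi x, Real.exp (-t ^ 2 / 2)

/-- Number of times `0 ≤ j ≤ n` at which the walk started from `d`, with steps `±1` read off `y`,
visits `0`. -/
def visitCount (n : ℕ) (d : ℤ) (y : Fin n → Bool) : ℕ :=
  ((Finset.range (n + 1)).filter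
    (fun j => d + 2 * ∑ i ∈ Finset.Icc 1 j, (extSeq n y i : ℤ) = j)).card

/-- Number of bit vectors of length `n` whose walk started from `d` visits `0` exactly `k` times. -/
def visitNum (n : ℕ) (d : ℤ) (k : ℕ) : ℕ :=
  (Finset.univ.filter (fun y : Fin n → Bool => visitCount n d y = k)).card

theorem leadCount_eq_visitCount (n : ℕ) (y : Fin n → Bool) :
    leadCount n (extSeq n y) = visitCount n 0 y := by
  unfold leadCount visitCount
  congr 1
  apply Finset.filter_congr
  intro j _
  rw [zero_add]
  norm_cast

theorem extSeq_cons_one (n : ℕ) (b : Bool) (y : Fin n → Bool) :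
    extSeq (n + 1) (Fin.cons b y : Fin (n + 1) → Bool) 1 = if b then 1 else 0 := by
  simp only [extSeq, le_refl, Nat.le_add_left, and_self, dite_true, Nat.sub_self]
  rfl

theorem extSeq_cons_succ (n : ℕ) (b : Bool) (y : Fin n → Bool) (i : ℕ) (hi : 1 ≤ i) :
    extSeq (n + 1) (Fin.cons b y : Fin (n + 1) → Bool) (i + 1) = extSeq n y i := by
  obtain ⟨i, rfl⟩ : ∃ j, i = j + 1 := ⟨i - 1, by omega⟩
  unfold extSeq
  by_cases h : i + 1 ≤ n
  · rw [dif_pos (by omega), dif_pos (by omega)]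
    have : (⟨i + 1 + 1 - 1, by omega⟩ : Fin (n + 1)) = Fin.succ ⟨i, by omega⟩ := rfl
    rw [this, Fin.cons_succ]
    rfl
  · rw [dif_neg (by omega), dif_neg (by omega)]

theorem sum_extSeq_cons (n : ℕ) (b : Bool) (y : Fin n → Bool) (j : ℕ) :
    ∑ i ∈ Finset.Icc 1 (j + 1), (extSeq (n + 1) (Fin.cons b y : Fin (n + 1) → Bool) i : ℤ)
      = (if b then 1 else 0) + ∑ i ∈ Finset.Icc 1 j, (extSeq n y i : ℤ) := by
  induction j with
  | zero => simp [extSeq_cons_one]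
  | succ j ih =>
    rw [Finset.sum_Icc_succ_top (by omega), ih, Finset.sum_Icc_succ_top (by omega),
      extSeq_cons_succ _ _ _ _ (by omega), add_assoc]

theorem visitCount_cons (n : ℕ) (d : ℤ) (b : Bool) (y : Fin n → Bool) :
    visitCount (n + 1) d (Fin.cons b y) =
      (if d = 0 then 1 else 0) + visitCount n (d + if b then 1 else -1) y := by
  unfold visitCount
  simp only [Finset.card_filter]
  rw [Finset.sum_range_succ', add_comm]
  congr 1
  · simp
  · apply Finset.sum_congr rfl
    intro j _
    rw [sum_extSeq_cons]
    congr 1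
    apply propext
    cases b <;> simp <;> constructor <;> intro h <;> linarith

theorem visitNum_zero (d : ℤ) (k : ℕ) :
    visitNum 0 d k = if k = (if d = 0 then 1 else 0) then 1 else 0 := by
  unfold visitNum visitCount
  by_cases hd : d = 0 <;> by_cases hk : k = 0 <;> by_cases hk' : k = 1 <;>
    simp_all [Finset.filter_singleton, eq_comm]

theorem visitNum_succ (n : ℕ) (d : ℤ) (k : ℕ) :
    visitNum (n + 1) d k =
      (Finset.univ.filter (fun y : Fin n → Bool =>
        (if d = 0 then 1 else 0) + visitCount n (d + 1) y = k)).card +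
      (Finset.univ.filter (fun y : Fin n → Bool =>
        (if d = 0 then 1 else 0) + visitCount n (d - 1) y = k)).card := by
  unfold visitNum
  simp only [Finset.card_filter]
  rw [← (Fin.consEquiv (fun _ : Fin (n + 1) => Bool)).sum_comp, Fintype.sum_prod_type]
  simp [Fin.consEquiv, visitCount_cons, sub_eq_add_neg]

theorem visitNum_succ_of_ne (n : ℕ) {d : ℤ} (hd : d ≠ 0) (k : ℕ) :
    visitNum (n + 1) d k = visitNum n (d + 1) k + visitNum n (d - 1) k := by
  rw [visitNum_succ]
  simp [hd, visitNum]

theorem visitNum_succ_zero_zero (n : ℕ) : visitNum (n + 1) 0 0 = 0 := by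
  rw [visitNum_succ]
  simp

theorem visitNum_succ_zero_succ (n k : ℕ) :
    visitNum (n + 1) 0 (k + 1) = visitNum n 1 k + visitNum n (-1) k := by
  rw [visitNum_succ]
  simp [visitNum, add_comm]

theorem visitNum_zero_zero (n : ℕ) : visitNum n 0 0 = 0 := by
  cases n with
  | zero => simp [visitNum_zero]
  | succ n => exact visitNum_succ_zero_zero n

theorem visitNum_neg (n : ℕ) (d : ℤ) (k : ℕ) : visitNum n (-d) k = visitNum n d k := by
  induction n generalizing d k with
  | zero => simp [visitNum_zero]
  | succ n ih =>
    by_cases hd : d = 0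
    · simp [hd]
    · rw [visitNum_succ_of_ne _ hd, visitNum_succ_of_ne _ (neg_ne_zero.mpr hd), add_comm,
        ← ih (d + 1), ← ih (d - 1)]
      congr 2 <;> ring

theorem visitNum_succ_zero_succ' (n k : ℕ) :
    visitNum (n + 1) 0 (k + 1) = 2 * visitNum n 1 k := by
  rw [visitNum_succ_zero_succ, visitNum_neg, two_mul]

theorem sum_range_choose_succ_succ (n h : ℕ) :
    ∑ i ∈ Finset.range (h + 1), (n + 1).choose i =
      ∑ i ∈ Finset.range (h + 1), n.choose i + ∑ i ∈ Finset.range h, n.choose i := by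
  rw [Finset.sum_range_succ', Finset.sum_range_succ']
  simp [Nat.choose_succ_succ, Finset.sum_add_distrib]
  ring

/-- The reflection principle: paths started from `d > 0` that avoid `0`. -/
theorem visitNum_pos_zero (n d h : ℕ) (hd : 0 < d) (hh : n + d = 2 * h) :
    visitNum n d 0 + ∑ i ∈ Finset.range (h - d), n.choose i =
      ∑ i ∈ Finset.range h, n.choose i := by
  induction n generalizing d h with
  | zero =>
    have h1 : h - d = 0 := by omega
    obtain ⟨h, rfl⟩ : ∃ j, h = j + 1 := ⟨h - 1, by omega⟩
    rw [visitNum_zero, h1, Finset.sum_range_succ']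
    simp [hd.ne']
  | succ n ih =>
    obtain ⟨h, rfl⟩ : ∃ j, h = j + 1 := ⟨h - 1, by omega⟩
    rw [visitNum_succ_of_ne _ (by exact_mod_cast hd.ne'), sum_range_choose_succ_succ]
    have h1 := ih (d + 1) (h + 1) (by omega) (by omega)
    have h2 : visitNum n ((d : ℤ) - 1) 0 + ∑ i ∈ Finset.range (h + 1 - d), n.choose i =
        ∑ i ∈ Finset.range h, n.choose i := by
      rcases Nat.lt_or_ge 1 d with hd1 | hd1
      · have := ih (d - 1) h (by omega) (by omega)
        rw [show h - (d - 1) = h + 1 - d by omega] at this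
        rwa [Nat.cast_sub hd] at this
      · obtain rfl : d = 1 := by omega
        simp only [Nat.cast_one, sub_self, Nat.add_sub_cancel]
        rw [visitNum_zero_zero, zero_add]
    have h3 : ∑ i ∈ Finset.range (h + 1 - d), (n + 1).choose i =
        ∑ i ∈ Finset.range (h + 1 - d), n.choose i +
          ∑ i ∈ Finset.range (h + 1 - (d + 1)), n.choose i := by
      rcases Nat.lt_or_ge h d with hd1 | hd1
      · simp [show h + 1 - d = 0 by omega, show h - d = 0 by omega]
      · rw [show h + 1 - d = (h - d) + 1 by omega, show h + 1 - (d + 1) = h - d by omega,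
          sum_range_choose_succ_succ]
    rw [Nat.cast_add, Nat.cast_one] at h1
    omega

theorem visitNum_eq_zero_of_lt (n : ℕ) (d : ℤ) (k : ℕ) (hk : n + 1 < k) : visitNum n d k = 0 := by
  unfold visitNum
  rw [Finset.card_eq_zero, Finset.filter_eq_empty_iff]
  intro y _
  have : visitCount n d y ≤ n + 1 := by
    unfold visitCount
    exact (Finset.card_filter_le _ _).trans (by simp)
  omega

theorem visitNum_succ_eq (n d h k : ℕ) (hh : n + d = 2 * h) (hk : k ≤ n) :
    visitNum n d (k + 1) = 2 ^ k * (n - k).choose h := by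
  induction n generalizing d h k with
  | zero =>
    obtain rfl : k = 0 := by omega
    rcases Nat.eq_zero_or_pos d with rfl | hd
    · obtain rfl : h = 0 := by omega
      simp [visitNum_zero]
    · rw [Nat.choose_eq_zero_of_lt (by omega)]
      simp [visitNum_zero, hd.ne']
  | succ n ih =>
    obtain ⟨h, rfl⟩ : ∃ j, h = j + 1 := ⟨h - 1, by omega⟩
    rcases Nat.eq_zero_or_pos d with rfl | hd
    · rw [Nat.cast_zero, visitNum_succ_zero_succ']
      cases k with
      | zero =>
        have h1 := visitNum_pos_zero n 1 (h + 1) one_pos (by omega)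
        rw [Nat.add_sub_cancel, Finset.sum_range_succ] at h1
        have h2 : n.choose h = n.choose (h + 1) := by
          rw [← Nat.choose_symm_of_eq_add (show n = h + (h + 1) by omega)]
        rw [Nat.sub_zero, Nat.choose_succ_succ, ← h2]
        push_cast at h1
        omega
      | succ k =>
        have h1 := ih 1 (h + 1) k (by omega) (by omega)
        push_cast at h1
        rw [h1, pow_succ, Nat.add_sub_add_right]
        ring
    · rw [visitNum_succ_of_ne _ (by exact_mod_cast hd.ne')]
      rcases Nat.lt_or_ge n k with hkn | hkn
      · rw [visitNum_eq_zero_of_lt _ _ _ (by omega), visitNum_eq_zero_of_lt _ _ _ (by omega),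
          Nat.choose_eq_zero_of_lt (by omega), mul_zero, add_zero]
      · have h1 := ih (d + 1) (h + 1) k (by omega) hkn
        have h2 := ih (d - 1) h k (by omega) hkn
        rw [Nat.cast_sub hd] at h2
        push_cast at h1 h2
        rw [h1, h2, Nat.succ_sub hkn, Nat.choose_succ_succ]
        ring

/-- The probability that the simple random walk of length `2 m` returns to `0` exactly `r` times. -/
noncomputable def returnProb (m r : ℕ) : ℝ := 2 ^ r * ((2 * m - r).choose m : ℝ) / 4 ^ m

theorem sum_leadCount_eq (m : ℕ) (f : ℕ → ℝ) :
    ((2 : ℝ) ^ (2 * m))⁻¹ * ∑ y : Fin (2 * m) → Bool, f (leadCount (2 * m) (extSeq (2 * m) y)) =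
      ∑ r ∈ Finset.range (2 * m + 1), returnProb m r * f (r + 1) := by
  have hmap : ∀ y ∈ (Finset.univ : Finset (Fin (2 * m) → Bool)),
      visitCount (2 * m) 0 y ∈ Finset.range (2 * m + 1 + 1) := by
    intro y _
    rw [Finset.mem_range, Nat.lt_succ_iff]
    unfold visitCount
    exact (Finset.card_filter_le _ _).trans (by simp)
  have h1 : ∑ y : Fin (2 * m) → Bool, f (leadCount (2 * m) (extSeq (2 * m) y)) =
      ∑ k ∈ Finset.range (2 * m + 1 + 1), (visitNum (2 * m) 0 k : ℝ) * f k := by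
    simp only [leadCount_eq_visitCount]
    rw [← Finset.sum_fiberwise_of_maps_to hmap]
    apply Finset.sum_congr rfl
    intro k _
    rw [Finset.sum_congr rfl (g := fun _ => f k)
      (fun y hy => by rw [(Finset.mem_filter.mp hy).2]), Finset.sum_const, nsmul_eq_mul]
    rfl
  rw [h1, Finset.sum_range_succ', visitNum_zero_zero, Nat.cast_zero, zero_mul, add_zero, Finset.mul_sum]
  apply Finset.sum_congr rfl
  intro r hr
  have h2 := visitNum_succ_eq (2 * m) 0 m r (by omega) (by rw [Finset.mem_range] at hr; omega)
  rw [Nat.cast_zero] at h2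
  rw [h2, returnProb, pow_mul]
  push_cast
  norm_num
  field_simp

theorem returnProb_nonneg (m r : ℕ) : 0 ≤ returnProb m r := by
  unfold returnProb
  positivity

theorem sum_returnProb (m : ℕ) : ∑ r ∈ Finset.range (2 * m + 1), returnProb m r = 1 := by
  have h := sum_leadCount_eq m (fun _ => 1)
  simp only [mul_one] at h
  rw [← h]
  simp

theorem returnProb_eq_zero_of_lt {m r : ℕ} (hm : 0 < m) (hr : m < r) : returnProb m r = 0 := by
  unfold returnProb
  rw [Nat.choose_eq_zero_of_lt (by omega)]
  simp

theorem returnProb_succ {m r : ℕ} (hr : r < m) :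
    returnProb m (r + 1) * (2 * m - r) = returnProb m r * (2 * m - 2 * r) := by
  have h := Nat.choose_mul_succ_eq (2 * m - (r + 1)) m
  rw [show 2 * m - (r + 1) + 1 = 2 * m - r by omega, show 2 * m - r - m = m - r by omega] at h
  have h' : ((2 * m - (r + 1)).choose m : ℝ) * (2 * m - r) = (2 * m - r).choose m * (m - r) := by
    have := congrArg (Nat.cast (R := ℝ)) h
    push_cast [Nat.cast_sub hr.le, Nat.cast_sub (show r ≤ 2 * m by omega)] at this
    exact this
  unfold returnProb
  rw [pow_succ]
  linear_combination (2 ^ r * 2 / 4 ^ m : ℝ) * h'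

theorem returnProb_le {m r : ℕ} (hr : r ≤ m) :
    returnProb m r ≤ returnProb m 0 * Real.exp (-(r * (r - 1) / (4 * m))) := by
  induction r with
  | zero => simp
  | succ r ih =>
    have hr' : (r : ℝ) < m := by exact_mod_cast hr
    have hr0 : (0 : ℝ) ≤ r := r.cast_nonneg
    have h1 : returnProb m (r + 1) = returnProb m r * ((2 * m - 2 * r) / (2 * m - r)) := by
      rw [mul_div_assoc', eq_div_iff (by linarith), returnProb_succ hr]
    have h2 : ((2 * m - 2 * r) / (2 * m - r) : ℝ) ≤ Real.exp (-(r / (2 * m))) := by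
      refine le_trans ?_ (Real.add_one_le_exp _)
      rw [div_le_iff₀ (by linarith)]
      have : (-(r / (2 * m)) + 1 : ℝ) * (2 * m - r) - (2 * m - 2 * r) = r ^ 2 / (2 * m) := by
        field_simp [show (m : ℝ) ≠ 0 by linarith]
        ring
      have : (0 : ℝ) ≤ r ^ 2 / (2 * m) := by positivity
      linarith
    calc returnProb m (r + 1)
        ≤ (returnProb m 0 * Real.exp (-(r * (r - 1) / (4 * m)))) * Real.exp (-(r / (2 * m))) := by
          rw [h1]
          exact mul_le_mul (ih (by omega)) h2 (div_nonneg (by linarith) (by linarith))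
            (mul_nonneg (returnProb_nonneg _ _) (Real.exp_pos _).le)
      _ = _ := by
          rw [mul_assoc, ← Real.exp_add]
          congr 2
          push_cast
          field_simp [show (m : ℝ) ≠ 0 by linarith]
          ring

theorem le_returnProb {m r R : ℕ} (hr : r ≤ R) (hR : R < m) :
    returnProb m 0 * Real.exp (-(r * (r - 1) / (4 * (m - R)))) ≤ returnProb m r := by
  induction r with
  | zero => simp
  | succ r ih =>
    have hr' : (r : ℝ) + 1 ≤ R := by exact_mod_cast hr
    have hR' : (R : ℝ) < m := by exact_mod_cast hR
    have hr0 : (0 : ℝ) ≤ r := r.cast_nonneg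
    have h1 : returnProb m (r + 1) = returnProb m r * ((2 * m - 2 * r) / (2 * m - r)) := by
      rw [mul_div_assoc', eq_div_iff (by linarith), returnProb_succ (by omega)]
    have h2 : Real.exp (-(r / (2 * (m - R)))) ≤ ((2 * m - 2 * r) / (2 * m - r) : ℝ) := by
      have h3 : ((2 * m - 2 * r) / (2 * m - r) : ℝ) = (r / (2 * (m - r)) + 1 : ℝ)⁻¹ := by
        have : (m : ℝ) - r ≠ 0 := by linarith
        have : 2 * (m : ℝ) - r ≠ 0 := by linarith
        have : (r / (2 * (m - r)) + 1 : ℝ) = (2 * m - r) / (2 * m - 2 * r) := by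
          rw [div_add_one (by simpa), ← mul_sub]
          congr 1
          ring
        rw [this, inv_div]
      rw [h3, Real.exp_neg]
      apply inv_anti₀ (by have : (0 : ℝ) < m - r := by linarith
                          positivity)
      refine le_trans (Real.add_one_le_exp _) (Real.exp_le_exp.mpr ?_)
      apply div_le_div_of_nonneg_left hr0 (by linarith) (by linarith)
    calc returnProb m 0 * Real.exp (-((r + 1 : ℕ) * ((r + 1 : ℕ) - 1) / (4 * (m - R))))
        = (returnProb m 0 * Real.exp (-(r * (r - 1) / (4 * (m - R))))) *
            Real.exp (-(r / (2 * (m - R)))) := by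
          rw [mul_assoc, ← Real.exp_add]
          congr 2
          push_cast
          field_simp [show (m : ℝ) - R ≠ 0 by linarith]
          ring
      _ ≤ returnProb m (r + 1) := by
          rw [h1]
          exact mul_le_mul (ih (by omega)) h2 (Real.exp_pos _).le (returnProb_nonneg _ _)

theorem returnProb_le_zero {m : ℕ} (hm : 0 < m) (r : ℕ) : returnProb m r ≤ returnProb m 0 := by
  rcases Nat.lt_or_ge m r with h | h
  · rw [returnProb_eq_zero_of_lt hm h]
    exact returnProb_nonneg _ _
  · refine (returnProb_le h).trans (mul_le_of_le_one_right (returnProb_nonneg _ _) ?_)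
    rw [Real.exp_le_one_iff, neg_nonpos]
    refine div_nonneg ?_ (by positivity)
    cases r with
    | zero => simp
    | succ r =>
      push_cast
      rw [add_sub_cancel_right]
      positivity

/-- Wallis' formula for the central binomial probability. -/
theorem tendsto_sqrt_mul_returnProb_zero :
    Filter.Tendsto (fun m : ℕ => Real.sqrt (2 * m) * returnProb m 0) Filter.atTop
      (nhds (Real.sqrt (2 / Real.pi))) := by
  have h1 : ∀ m : ℕ, Real.sqrt (2 * m) * returnProb m 0 =
      Real.sqrt (2 * m / (2 * m + 1) * (Real.Wallis.W m)⁻¹) := by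
    intro m
    rw [eq_comm, Real.sqrt_eq_iff_mul_self_eq (by have := Real.Wallis.W_pos m; positivity)
      (mul_nonneg (Real.sqrt_nonneg _) (returnProb_nonneg _ _)), mul_mul_mul_comm,
      Real.mul_self_sqrt (by positivity), Real.Wallis.W_eq_factorial_ratio]
    unfold returnProb
    have h2 : ((2 * m).choose m : ℝ) = (2 * m).factorial / (m.factorial * m.factorial) := by
      rw [Nat.cast_choose ℝ (by omega), show 2 * m - m = m by omega]
    rw [Nat.sub_zero, h2, show (4 : ℝ) = 2 ^ 2 by norm_num, ← pow_mul, pow_zero]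
    have h3 : (m.factorial : ℝ) ≠ 0 := by exact_mod_cast m.factorial_ne_zero
    have h4 : ((2 * m).factorial : ℝ) ≠ 0 := by exact_mod_cast (2 * m).factorial_ne_zero
    have h5 : (2 : ℝ) ^ (4 * m) = 2 ^ (2 * m) * 2 ^ (2 * m) := by
      rw [← pow_add]
      congr 1
      ring
    rw [h5]
    field_simp
  simp_rw [h1]
  have h6 : Filter.Tendsto (fun m : ℕ => (2 * m / (2 * m + 1) : ℝ)) Filter.atTop (nhds 1) := by
    have : Filter.Tendsto (fun m : ℕ => (2 * m : ℝ)) Filter.atTop Filter.atTop :=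
      tendsto_natCast_atTop_atTop.const_mul_atTop two_pos
    have h7 : Filter.Tendsto (fun m : ℕ => (1 - (2 * m + 1 : ℝ)⁻¹)) Filter.atTop (nhds (1 - 0)) :=
      tendsto_const_nhds.sub
        (tendsto_inv_atTop_zero.comp (Filter.tendsto_atTop_add_const_right _ 1 this))
    rw [sub_zero] at h7
    refine h7.congr fun m => ?_
    have : (2 * m + 1 : ℝ) ≠ 0 := by positivity
    field_simp
    ring
  have h8 := h6.mul (Real.Wallis.tendsto_W_nhds_pi_div_two.inv₀ (by positivity))
  rw [one_mul, inv_div] at h8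
  exact (Real.continuous_sqrt.tendsto _).comp h8

theorem integral_natFloor (h : ℕ → ℝ) (R : ℕ) {B : ℝ} (hB : R ≤ B) (hz : ∀ r, R ≤ r → h r = 0) :
    ∫ u in (0 : ℝ)..B, h ⌊u⌋₊ = ∑ r ∈ Finset.range R, h r := by
  have hc : ∀ r : ℕ, Set.EqOn (fun _ => h r) (fun u : ℝ => h ⌊u⌋₊)
      (Set.Ioo (r : ℝ) ((r + 1 : ℕ) : ℝ)) := by
    intro r u hu
    have : ⌊u⌋₊ = r := by
      rw [Nat.floor_eq_iff (r.cast_nonneg.trans hu.1.le)]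
      exact ⟨hu.1.le, by exact_mod_cast hu.2⟩
    simp [this]
  have hle : ∀ r : ℕ, (r : ℝ) ≤ ((r + 1 : ℕ) : ℝ) := fun r => by exact_mod_cast r.le_succ
  have hint : ∀ r : ℕ, IntervalIntegrable (fun u : ℝ => h ⌊u⌋₊) MeasureTheory.volume
      (r : ℝ) ((r + 1 : ℕ) : ℝ) := by
    intro r
    refine (intervalIntegrable_const (c := h r)).congr_uIoo ?_
    rw [Set.uIoo_of_le (hle r)]
    exact hc r
  have h1 : ∫ u in (0 : ℝ)..R, h ⌊u⌋₊ = ∑ r ∈ Finset.range R, h r := by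
    have := intervalIntegral.sum_integral_adjacent_intervals (f := fun u : ℝ => h ⌊u⌋₊)
      (μ := MeasureTheory.volume) (a := fun k : ℕ => (k : ℝ)) (n := R) (fun k _ => hint k)
    rw [Nat.cast_zero] at this
    rw [← this]
    apply Finset.sum_congr rfl
    intro r _
    rw [← intervalIntegral.integral_congr_Ioo_of_le (hle r) (hc r)]
    simp
  have hz' : Set.EqOn (fun _ => (0 : ℝ)) (fun u : ℝ => h ⌊u⌋₊) (Set.uIcc (R : ℝ) B) := by
    intro u hu
    rw [Set.uIcc_of_le hB] at hu
    exact (hz _ (Nat.le_floor hu.1)).symm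
  have h2 : IntervalIntegrable (fun u : ℝ => h ⌊u⌋₊) MeasureTheory.volume 0 R := by
    have := IntervalIntegrable.trans_iterate (f := fun u : ℝ => h ⌊u⌋₊)
      (μ := MeasureTheory.volume) (a := fun k : ℕ => (k : ℝ)) (n := R) (fun k _ => hint k)
    rwa [Nat.cast_zero] at this
  have h3 : IntervalIntegrable (fun u : ℝ => h ⌊u⌋₊) MeasureTheory.volume R B :=
    (intervalIntegrable_const (c := (0 : ℝ))).congr_uIoo
      (hz'.mono Set.Ioo_subset_Icc_self)
  rw [← intervalIntegral.integral_add_adjacent_intervals h2 h3, h1,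
    ← intervalIntegral.integral_congr hz']
  simp

/-- `returnProb m` weighted by the relative amount by which the lead-change count falls short of
the threshold `an (2 * m)`. -/
noncomputable def deficit (m r : ℕ) : ℝ := returnProb m r * max 0 (1 - (r + 1) / an (2 * m))

theorem an_pos (n : ℕ) : 0 < an n := by
  unfold an
  have := Real.pi_pos
  positivity

theorem an_le_sqrt {m : ℕ} (hm : 0 < m) : an (2 * m) ≤ Real.sqrt (2 * m) := by
  unfold an
  apply Real.sqrt_le_sqrt
  rw [div_le_iff₀ Real.pi_pos]
  have h1 : (1 : ℝ) ≤ m := by exact_mod_cast hm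
  have h2 := Real.pi_gt_three
  push_cast
  nlinarith

theorem En_div_an_eq (m : ℕ) :
    En (2 * m) / an (2 * m) = 1 - ∑ r ∈ Finset.range (2 * m + 1), deficit m r := by
  have ha := an_pos (2 * m)
  have h := sum_leadCount_eq m (fun x => min x (an (2 * m)))
  simp only [Nat.cast_add, Nat.cast_one] at h
  have hE : En (2 * m) = ∑ r ∈ Finset.range (2 * m + 1),
      returnProb m r * min (r + 1 : ℝ) (an (2 * m)) := by
    rw [← h]
    rfl
  conv_rhs => rw [← sum_returnProb m, ← Finset.sum_sub_distrib]
  rw [hE, Finset.sum_div]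
  apply Finset.sum_congr rfl
  intro r _
  have : min (r + 1 : ℝ) (an (2 * m)) / an (2 * m) = 1 - max 0 (1 - (r + 1) / an (2 * m)) := by
    rcases le_total (r + 1 : ℝ) (an (2 * m)) with h | h
    · rw [min_eq_left h, max_eq_right (by rw [sub_nonneg, div_le_one ha]; exact h)]
      ring
    · rw [min_eq_right h, max_eq_left (by rw [sub_nonpos, one_le_div ha]; exact h),
        div_self ha.ne', sub_zero]
  rw [mul_div_assoc, this, deficit]
  ring

theorem sum_deficit_eq_integral {m : ℕ} (hm : 0 < m) :
    ∑ r ∈ Finset.range (2 * m + 1), deficit m r =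
      ∫ x in (0 : ℝ)..2, Real.sqrt (2 * m) * deficit m ⌊Real.sqrt (2 * m) * x⌋₊ := by
  have hs1 : 1 ≤ Real.sqrt (2 * m) := by
    rw [Real.one_le_sqrt]
    have h1 : (1 : ℝ) ≤ m := by exact_mod_cast hm
    linarith
  have hs2 : Real.sqrt (2 * m) ≤ 2 * m := by
    nlinarith [Real.mul_self_sqrt (show (0 : ℝ) ≤ 2 * m by positivity)]
  have ha := an_le_sqrt hm
  have ha0 := an_pos (2 * m)
  have hceil := Nat.ceil_lt_add_one ha0.le
  have hz : ∀ r, ⌈an (2 * m)⌉₊ ≤ r → deficit m r = 0 := by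
    intro r hr
    rw [deficit, max_eq_left, mul_zero]
    rw [sub_nonpos, one_le_div ha0]
    linarith [Nat.ceil_le.mp hr]
  rw [intervalIntegral.integral_const_mul,
    intervalIntegral.mul_integral_comp_mul_left (f := fun u : ℝ => deficit m ⌊u⌋₊), mul_zero,
    integral_natFloor (deficit m) ⌈an (2 * m)⌉₊ (by linarith) hz]
  symm
  apply Finset.sum_subset
  · apply Finset.range_subset_range.mpr
    have : (⌈an (2 * m)⌉₊ : ℝ) < (2 * m + 1 : ℕ) := by
      push_cast
      linarith
    exact_mod_cast this.le
  · intro r _ hr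
    exact hz r (by simpa using hr)

theorem tendsto_sqrt_two_mul :
    Filter.Tendsto (fun m : ℕ => Real.sqrt (2 * m)) Filter.atTop Filter.atTop :=
  Real.tendsto_sqrt_atTop.comp (tendsto_natCast_atTop_atTop.const_mul_atTop two_pos)

theorem tendsto_floor_div_sqrt {x : ℝ} (hx : 0 ≤ x) :
    Filter.Tendsto (fun m : ℕ => (⌊Real.sqrt (2 * m) * x⌋₊ : ℝ) / Real.sqrt (2 * m))
      Filter.atTop (nhds x) := by
  simp_rw [mul_comm _ x]
  exact (tendsto_nat_floor_mul_div_atTop hx).comp tendsto_sqrt_two_mul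

theorem tendsto_inv_sqrt_two_mul :
    Filter.Tendsto (fun m : ℕ => (Real.sqrt (2 * m))⁻¹) Filter.atTop (nhds 0) :=
  tendsto_inv_atTop_zero.comp tendsto_sqrt_two_mul

/-- Local limit theorem for the number of returns to `0`. -/
theorem tendsto_sqrt_mul_returnProb {x : ℝ} (hx : 0 ≤ x) :
    Filter.Tendsto (fun m : ℕ => Real.sqrt (2 * m) * returnProb m ⌊Real.sqrt (2 * m) * x⌋₊)
      Filter.atTop (nhds (Real.sqrt (2 / Real.pi) * Real.exp (-x ^ 2 / 2))) := by
  set q : ℕ → ℝ := fun m => (⌊Real.sqrt (2 * m) * x⌋₊ : ℝ) / Real.sqrt (2 * m) with hq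
  set i : ℕ → ℝ := fun m => (Real.sqrt (2 * m))⁻¹ with hi
  have hqt : Filter.Tendsto q Filter.atTop (nhds x) := tendsto_floor_div_sqrt hx
  have hit : Filter.Tendsto i Filter.atTop (nhds 0) := tendsto_inv_sqrt_two_mul
  have hqi : Filter.Tendsto (fun m => q m * i m) Filter.atTop (nhds 0) := by
    simpa using hqt.mul hit
  have hpos : ∀ᶠ m : ℕ in Filter.atTop, 0 < m := Filter.eventually_gt_atTop 0
  have hlt : ∀ᶠ m : ℕ in Filter.atTop, q m * i m < 1 / 2 := hqi.eventually_lt_const (by norm_num)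
  have hex : ∀ m : ℕ, 0 < m → (⌊Real.sqrt (2 * m) * x⌋₊ : ℝ) = q m * Real.sqrt (2 * m) ∧
      0 < Real.sqrt (2 * m) ∧ Real.sqrt (2 * m) * Real.sqrt (2 * m) = 2 * m ∧
      i m * Real.sqrt (2 * m) = 1 := by
    intro m hm
    have hs : 0 < Real.sqrt (2 * m) := Real.sqrt_pos.mpr (by positivity)
    refine ⟨(div_mul_cancel₀ _ hs.ne').symm, hs, Real.mul_self_sqrt (by positivity),
      inv_mul_cancel₀ hs.ne'⟩
  clear_value q i
  have hR : ∀ m : ℕ, 0 < m → q m * i m < 1 / 2 → ⌊Real.sqrt (2 * m) * x⌋₊ < m := by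
    intro m hm h
    obtain ⟨h1, h2, h3, h4⟩ := hex m hm
    have : (⌊Real.sqrt (2 * m) * x⌋₊ : ℝ) < m := by
      rw [h1]
      have : q m * Real.sqrt (2 * m) = (q m * i m) * (2 * m) := by
        linear_combination q m * i m * h3 - q m * Real.sqrt (2 * m) * h4
      have hm' : (0 : ℝ) < m := by exact_mod_cast hm
      rw [this]
      nlinarith
    exact_mod_cast this
  have hup : Filter.Tendsto (fun m : ℕ => Real.sqrt (2 * m) * returnProb m 0 *
      Real.exp (-(q m * (q m - i m) / 2))) Filter.atTop
      (nhds (Real.sqrt (2 / Real.pi) * Real.exp (-(x * (x - 0) / 2)))) :=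
    tendsto_sqrt_mul_returnProb_zero.mul
      ((Real.continuous_exp.tendsto _).comp (((hqt.mul (hqt.sub hit)).div_const 2).neg))
  have hlow : Filter.Tendsto (fun m : ℕ => Real.sqrt (2 * m) * returnProb m 0 *
      Real.exp (-(q m * (q m - i m) / (2 * (1 - 2 * (q m * i m)))))) Filter.atTop
      (nhds (Real.sqrt (2 / Real.pi) * Real.exp (-(x * (x - 0) / (2 * (1 - 2 * 0)))))) :=
    tendsto_sqrt_mul_returnProb_zero.mul
      ((Real.continuous_exp.tendsto _).comp ((((hqt.mul (hqt.sub hit)).div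
        (tendsto_const_nhds.mul (tendsto_const_nhds.sub (tendsto_const_nhds.mul hqi)))
        (by norm_num))).neg))
  have e1 : -(x * (x - 0) / 2) = -x ^ 2 / 2 := by ring
  have e2 : -(x * (x - 0) / (2 * (1 - 2 * 0))) = -x ^ 2 / 2 := by ring
  rw [e1] at hup
  rw [e2] at hlow
  refine tendsto_of_tendsto_of_tendsto_of_le_of_le' hlow hup ?_ ?_
  · filter_upwards [hpos, hlt] with m hm hl
    obtain ⟨h1, h2, h3, h4⟩ := hex m hm
    have := le_returnProb le_rfl (hR m hm hl)
    rw [mul_assoc]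
    refine mul_le_mul_of_nonneg_left (le_trans (le_of_eq ?_) this) h2.le
    congr 2
    rw [h1, neg_inj]
    have h5 : (4 * (m - q m * Real.sqrt (2 * m)) : ℝ) =
        (2 * (1 - 2 * (q m * i m))) * (Real.sqrt (2 * m) * Real.sqrt (2 * m)) := by
      linear_combination (-2 : ℝ) * h3 + 4 * q m * Real.sqrt (2 * m) * h4
    have h6 : q m * Real.sqrt (2 * m) * (q m * Real.sqrt (2 * m) - 1) =
        (q m * (q m - i m)) * (Real.sqrt (2 * m) * Real.sqrt (2 * m)) := by
      linear_combination q m * Real.sqrt (2 * m) * h4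
    rw [h5, h6, mul_div_mul_right _ _ (by positivity)]
  · filter_upwards [hpos, hlt] with m hm hl
    obtain ⟨h1, h2, h3, h4⟩ := hex m hm
    have := returnProb_le (hR m hm hl).le
    rw [mul_assoc]
    refine mul_le_mul_of_nonneg_left (le_trans this (le_of_eq ?_)) h2.le
    congr 2
    rw [h1, neg_inj]
    have h5 : (4 * m : ℝ) = 2 * (Real.sqrt (2 * m) * Real.sqrt (2 * m)) := by
      rw [h3]
      ring
    have h6 : q m * Real.sqrt (2 * m) * (q m * Real.sqrt (2 * m) - 1) =
        (q m * (q m - i m)) * (Real.sqrt (2 * m) * Real.sqrt (2 * m)) := by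
      linear_combination q m * Real.sqrt (2 * m) * h4
    rw [h5, h6, mul_div_mul_right _ _ (by positivity)]

theorem tendsto_an_div_sqrt :
    Filter.Tendsto (fun m : ℕ => an (2 * m) / Real.sqrt (2 * m)) Filter.atTop
      (nhds (Real.sqrt (2 / Real.pi))) := by
  have h1 : Filter.Tendsto (fun m : ℕ => Real.sqrt (2 / Real.pi *
      (1 + (Real.sqrt (2 * m))⁻¹ * (Real.sqrt (2 * m))⁻¹))) Filter.atTop
      (nhds (Real.sqrt (2 / Real.pi * (1 + 0 * 0)))) :=
    (Real.continuous_sqrt.tendsto _).comp (tendsto_const_nhds.mul (tendsto_const_nhds.add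
      (tendsto_inv_sqrt_two_mul.mul tendsto_inv_sqrt_two_mul)))
  rw [mul_zero, add_zero, mul_one] at h1
  refine h1.congr' ?_
  filter_upwards [Filter.eventually_gt_atTop 0] with m hm
  have hm' : (0 : ℝ) < m := by exact_mod_cast hm
  rw [← mul_inv, Real.mul_self_sqrt (by positivity), an, ← Real.sqrt_div' _ (by positivity)]
  congr 1
  have := Real.pi_pos
  push_cast
  field_simp

theorem tendsto_sqrt_mul_deficit {x : ℝ} (hx : 0 ≤ x) :
    Filter.Tendsto (fun m : ℕ => Real.sqrt (2 * m) * deficit m ⌊Real.sqrt (2 * m) * x⌋₊)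
      Filter.atTop (nhds (Real.sqrt (2 / Real.pi) * Real.exp (-x ^ 2 / 2) *
        max 0 (1 - x / Real.sqrt (2 / Real.pi)))) := by
  have hb : 0 < Real.sqrt (2 / Real.pi) := Real.sqrt_pos.mpr (div_pos two_pos Real.pi_pos)
  have h1 : Filter.Tendsto (fun m : ℕ => ((⌊Real.sqrt (2 * m) * x⌋₊ : ℝ) + 1) / an (2 * m))
      Filter.atTop (nhds ((x + 0) / Real.sqrt (2 / Real.pi))) := by
    refine (((tendsto_floor_div_sqrt hx).add tendsto_inv_sqrt_two_mul).div
      tendsto_an_div_sqrt hb.ne').congr' ?_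
    filter_upwards [Filter.eventually_gt_atTop 0] with m hm
    have hs : 0 < Real.sqrt (2 * m) := Real.sqrt_pos.mpr (by positivity)
    simp only [Pi.div_apply]
    rw [inv_eq_one_div, ← add_div, div_div_div_cancel_right₀ hs.ne']
  rw [add_zero] at h1
  have h2 := (tendsto_sqrt_mul_returnProb hx).mul
    ((tendsto_const_nhds (x := (0 : ℝ))).max ((tendsto_const_nhds (x := (1 : ℝ))).sub h1))
  refine h2.congr fun m => ?_
  rw [deficit, mul_assoc]

theorem tendsto_sum_deficit :
    Filter.Tendsto (fun m : ℕ => ∑ r ∈ Finset.range (2 * m + 1), deficit m r) Filter.atTop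
      (nhds (∫ x in (0 : ℝ)..2, Real.sqrt (2 / Real.pi) * Real.exp (-x ^ 2 / 2) *
        max 0 (1 - x / Real.sqrt (2 / Real.pi)))) := by
  have hpos : ∀ᶠ m : ℕ in Filter.atTop, 0 < m := Filter.eventually_gt_atTop 0
  have hC := tendsto_sqrt_mul_returnProb_zero.eventually_lt_const (lt_add_one _)
  refine Filter.Tendsto.congr' (f₁ := fun m : ℕ => ∫ x in (0 : ℝ)..2,
    Real.sqrt (2 * m) * deficit m ⌊Real.sqrt (2 * m) * x⌋₊) ?_ ?_
  · filter_upwards [hpos] with m hm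
    exact (sum_deficit_eq_integral hm).symm
  · refine intervalIntegral.tendsto_integral_filter_of_dominated_convergence
      (fun _ => Real.sqrt (2 / Real.pi) + 1) ?_ ?_ intervalIntegrable_const ?_
    · refine Filter.Eventually.of_forall fun m => Measurable.aestronglyMeasurable ?_
      exact measurable_const.mul ((measurable_from_nat (f := deficit m)).comp
        (Nat.measurable_floor.comp (measurable_const.mul measurable_id)))
    · filter_upwards [hpos, hC] with m hm h
      refine Filter.Eventually.of_forall fun x _ => ?_
      have h1 := returnProb_nonneg m ⌊Real.sqrt (2 * m) * x⌋₊
      have h2 := returnProb_le_zero hm ⌊Real.sqrt (2 * m) * x⌋₊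
      have h3 : max 0 (1 - ((⌊Real.sqrt (2 * m) * x⌋₊ : ℝ) + 1) / an (2 * m)) ≤ 1 := by
        have := an_pos (2 * m)
        refine max_le zero_le_one (sub_le_self _ (by positivity))
      rw [deficit, Real.norm_of_nonneg (by positivity)]
      refine le_trans (mul_le_mul_of_nonneg_left ?_ (Real.sqrt_nonneg _)) h.le
      exact (mul_le_of_le_one_right h1 h3).trans h2
    · refine Filter.Eventually.of_forall fun x hx => tendsto_sqrt_mul_deficit ?_
      rw [Set.uIoc_of_le zero_le_two] at hx
      exact hx.1.le

theorem integral_mul_exp_neg_sq_div_two (b : ℝ) :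
    ∫ x in (0 : ℝ)..b, x * Real.exp (-x ^ 2 / 2) = 1 - Real.exp (-b ^ 2 / 2) := by
  have h : ∀ x ∈ Set.uIcc 0 b, HasDerivAt (fun x : ℝ => -Real.exp (-x ^ 2 / 2))
      (x * Real.exp (-x ^ 2 / 2)) x := by
    intro x _
    refine (((hasDerivAt_pow 2 x).fun_neg.div_const 2).exp).fun_neg.congr_deriv ?_
    push_cast
    ring
  rw [intervalIntegral.integral_eq_sub_of_hasDerivAt h
    (Continuous.intervalIntegrable (by fun_prop) _ _)]
  simp
  ring

theorem integral_exp_neg_sq_div_two_eq (b : ℝ) :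
    Real.sqrt (2 / Real.pi) * ∫ x in (0 : ℝ)..b, Real.exp (-x ^ 2 / 2) = 1 - 2 * gaussQ b := by
  have hi : MeasureTheory.Integrable (fun x : ℝ => Real.exp (-x ^ 2 / 2)) := by
    refine (integrable_exp_neg_mul_sq (b := 1 / 2) (by norm_num)).congr
      (Filter.Eventually.of_forall fun x => ?_)
    simp only
    congr 1
    ring
  have h1 : ∫ x in Set.Ioi (0 : ℝ), Real.exp (-x ^ 2 / 2) = Real.sqrt (Real.pi / (1 / 2)) / 2 := by
    rw [← integral_gaussian_Ioi]
    congr 1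
    ext x
    congr 1
    ring
  have h2 := intervalIntegral.integral_interval_add_Ioi' (a := 0) (b := b)
    hi.integrableOn.intervalIntegrable hi.integrableOn
  rw [gaussQ, eq_sub_of_add_eq h2, h1, mul_sub]
  have hp : 0 < Real.sqrt Real.pi := Real.sqrt_pos.mpr Real.pi_pos
  have h3 : Real.sqrt 2 * Real.sqrt 2 = 2 := Real.mul_self_sqrt zero_le_two
  rw [Real.sqrt_div zero_le_two, Real.sqrt_mul zero_le_two,
    show Real.pi / (1 / 2) = 2 * Real.pi by ring, Real.sqrt_mul zero_le_two]
  have h4 : Real.sqrt 2 / Real.sqrt Real.pi * (Real.sqrt 2 * Real.sqrt Real.pi / 2) = 1 := by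
    field_simp
    linarith
  have h5 : 2 * (Real.sqrt 2 * Real.sqrt Real.pi)⁻¹ = Real.sqrt 2 / Real.sqrt Real.pi := by
    field_simp
    linarith
  rw [h4, ← mul_assoc, h5]

theorem integral_limit_deficit :
    ∫ x in (0 : ℝ)..2, Real.sqrt (2 / Real.pi) * Real.exp (-x ^ 2 / 2) *
        max 0 (1 - x / Real.sqrt (2 / Real.pi)) =
      Real.exp (-(1 / Real.pi)) - 2 * gaussQ (Real.sqrt (2 / Real.pi)) := by
  set b := Real.sqrt (2 / Real.pi) with hb
  have hb0 : 0 < b := Real.sqrt_pos.mpr (div_pos two_pos Real.pi_pos)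
  have hbsq : b ^ 2 = 2 / Real.pi := Real.sq_sqrt (div_pos two_pos Real.pi_pos).le
  have hb2 : b ≤ 2 := by
    have : 2 / Real.pi ≤ 1 := by
      rw [div_le_one Real.pi_pos]
      linarith [Real.pi_gt_three]
    nlinarith
  have hcont : Continuous fun x : ℝ => b * Real.exp (-x ^ 2 / 2) * max 0 (1 - x / b) := by
    fun_prop
  rw [← intervalIntegral.integral_add_adjacent_intervals (hcont.intervalIntegrable 0 b)
    (hcont.intervalIntegrable b 2)]
  have h1 : ∫ x in b..2, b * Real.exp (-x ^ 2 / 2) * max 0 (1 - x / b) = 0 := by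
    rw [intervalIntegral.integral_congr (g := fun _ => (0 : ℝ))]
    · simp
    · intro x hx
      rw [Set.uIcc_of_le hb2] at hx
      simp only
      rw [max_eq_left, mul_zero]
      rw [sub_nonpos, one_le_div hb0]
      exact hx.1
  have h2 : ∫ x in (0 : ℝ)..b, b * Real.exp (-x ^ 2 / 2) * max 0 (1 - x / b) =
      ∫ x in (0 : ℝ)..b, (b * Real.exp (-x ^ 2 / 2) - x * Real.exp (-x ^ 2 / 2)) := by
    apply intervalIntegral.integral_congr
    intro x hx
    rw [Set.uIcc_of_le hb0.le] at hx
    simp only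
    rw [max_eq_right]
    · field_simp
    · rw [sub_nonneg, div_le_one hb0]
      exact hx.2
  rw [h1, h2, add_zero, intervalIntegral.integral_sub
    (Continuous.intervalIntegrable (by fun_prop) _ _)
    (Continuous.intervalIntegrable (by fun_prop) _ _), intervalIntegral.integral_const_mul,
    integral_exp_neg_sq_div_two_eq, integral_mul_exp_neg_sq_div_two, hbsq,
    show -(2 / Real.pi) / 2 = -(1 / Real.pi) by ring]
  ring

/-- **Limiting normalized truncated lead-change count.** Along even `n → ∞`,
`En n / an n → 1 - e^{-1/π} + 2 Q(√(2/π))`. -/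
theorem limiting_truncated_lead_change_count :
    Filter.Tendsto (fun n : ℕ => En n / an n)
      (Filter.atTop ⊓ Filter.principal {n : ℕ | Even n})
      (nhds (1 - Real.exp (-(1 / Real.pi)) + 2 * gaussQ (Real.sqrt (2 / Real.pi)))) := by
  have h1 : Filter.Tendsto (fun m : ℕ => En (2 * m) / an (2 * m)) Filter.atTop
      (nhds (1 - Real.exp (-(1 / Real.pi)) + 2 * gaussQ (Real.sqrt (2 / Real.pi)))) := by
    have h := (tendsto_const_nhds (x := (1 : ℝ))).sub tendsto_sum_deficit
    rw [integral_limit_deficit, ← sub_add] at h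
    exact h.congr fun m => (En_div_an_eq m).symm
  have h2 : Filter.Tendsto (fun n : ℕ => n / 2)
      (Filter.atTop ⊓ Filter.principal {n : ℕ | Even n}) Filter.atTop :=
    (Nat.tendsto_div_const_atTop two_ne_zero).mono_left inf_le_left
  refine (h1.comp h2).congr' ?_
  filter_upwards [Filter.mem_inf_of_right (Filter.mem_principal_self _)] with n hn
  rw [Function.comp_apply, Nat.two_mul_div_two_of_even hn]
end
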